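/- In the algebra B_ζ, the element w = ((1+ι)/2)v + ((1−ι)/2)u²v satisfies w² = u²v² and w⁴ = v⁴; moreover (vs)² = u²v², and the element w'' = ((1+ι)/2)vs + ((1−ι)/2)u²vs satisfies w''² = v² and w''⁴ = v⁴. -/

import Mathlib

open TensorProduct

theorem sq_smul_add_smul_mul_of_commute {K B : Type*} [Field K] [Ring B] [Algebra K B]
    {ι : K} (hι : ι ^ 2 = -1) (h2 : (2 : K) ≠ 0) {a z : B} (ha : a ^ 2 = 1)
    (haz : Commute a z) :
    (((2 : K)⁻¹ * (1 + ι)) • z + ((2 : K)⁻¹ * (1 - ι)) • (a * z)) ^ 2 = a * z ^ 2 := by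
  have hleft : z * (a * z) = a * z ^ 2 := by
    rw [← mul_assoc, ← haz.eq, mul_assoc, ← sq]
  have hright : a * z * z = a * z ^ 2 := by rw [mul_assoc, ← sq]
  have hboth : a * z * (a * z) = z ^ 2 := by
    rw [← sq, haz.mul_pow, ha, one_mul]
  have hsum : (2 : K)⁻¹ * (1 + ι) * ((2 : K)⁻¹ * (1 + ι)) +
      (2 : K)⁻¹ * (1 - ι) * ((2 : K)⁻¹ * (1 - ι)) = 0 := by
    field_simp
    linear_combination 2 * hι
  have hcross : (2 : K)⁻¹ * (1 + ι) * ((2 : K)⁻¹ * (1 - ι)) +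
      (2 : K)⁻¹ * (1 - ι) * ((2 : K)⁻¹ * (1 + ι)) = 1 := by
    field_simp
    linear_combination -2 * hι
  generalize (2 : K)⁻¹ * (1 + ι) = α at *
  generalize (2 : K)⁻¹ * (1 - ι) = β at *
  calc (α • z + β • (a * z)) ^ 2
      = (α * α + β * β) • z ^ 2 + (α * β + β * α) • (a * z ^ 2) := by
        rw [sq (α • z + _)]
        simp only [add_mul, mul_add, smul_mul_smul_comm, hleft, hright, hboth, ← sq z]
        module
    _ = a * z ^ 2 := by rw [hsum, hcross, zero_smul, one_smul, zero_add]

theorem w_squares (K : Type*) [Field K] (ι : K) (hι : ι ^ 2 = -1)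
    (h8 : ∃ θ : K, θ ^ 2 = ι) (h2 : (2 : K) ≠ 0)
    (ζ : K) (hζ : ζ ^ 4 = 1)
    (B : Type*) [Ring B] [Algebra K B]
    (u v r s : B)
    (hu4 : u ^ 4 = 1) (huv : u * v = v * u)
    (hv2 : v ^ 2 = (2 : K)⁻¹ • (1 + ζ • u + u ^ 2 - ζ • u ^ 3))
    (hr2 : r ^ 2 = 1) (hrs : r * s = s * r) (hs2 : s ^ 2 = 1)
    (hru : r * u = u ^ 3 * r) (hrv : r * v = u ^ 3 * v * r)
    (hsu : s * u = u * s) (hsv : s * v = u ^ 2 * v * s)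
    (w w'' : B)
    (hw : w = ((2 : K)⁻¹ * (1 + ι)) • v + ((2 : K)⁻¹ * (1 - ι)) • (u ^ 2 * v))
    (hw'' : w'' = ((2 : K)⁻¹ * (1 + ι)) • (v * s) + ((2 : K)⁻¹ * (1 - ι)) • (u ^ 2 * v * s)) :
    w ^ 2 = u ^ 2 * v ^ 2 ∧ w ^ 4 = v ^ 4 ∧ (v * s) ^ 2 = u ^ 2 * v ^ 2 ∧
      w'' ^ 2 = v ^ 2 ∧ w'' ^ 4 = v ^ 4 := by
  have ha : (u ^ 2) ^ 2 = 1 := by rw [← pow_mul]; exact hu4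
  have hv : Commute (u ^ 2) v := Commute.pow_left huv 2
  have hs : Commute (u ^ 2) s := Commute.pow_left (Commute.symm hsu) 2
  have hw2 : w ^ 2 = u ^ 2 * v ^ 2 := by
    rw [hw, sq_smul_add_smul_mul_of_commute hι h2 ha hv]
  have hvs : (v * s) ^ 2 = u ^ 2 * v ^ 2 := by
    calc (v * s) ^ 2 = v * (s * v) * s := by simp only [sq, mul_assoc]
      _ = v * u ^ 2 * v * s ^ 2 := by rw [hsv]; simp only [sq, mul_assoc]
      _ = u ^ 2 * v ^ 2 := by rw [hs2, mul_one, ← hv.eq, mul_assoc, ← sq]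
  have hw''2 : w'' ^ 2 = v ^ 2 := by
    rw [hw'', mul_assoc (u ^ 2) v s,
      sq_smul_add_smul_mul_of_commute hι h2 ha (hv.mul_right hs), hvs, ← mul_assoc, ← sq, ha,
      one_mul]
  refine ⟨hw2, ?_, hvs, hw''2, ?_⟩
  · rw [show 4 = 2 * 2 from rfl, pow_mul, hw2, (hv.pow_right 2).mul_pow, ha, one_mul, ← pow_mul]
  · rw [show 4 = 2 * 2 from rfl, pow_mul, hw''2, ← pow_mul]
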